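/- Assume Γ is Q-polynomial with respect to E. Then for all vertices x, y ∈ X at distance ∂(x,y) = d: E x̂ ⋆ E ŷ = [ (θ*_{d-1} − θ*_d) C(x,y) + (θ₂ − θ₀)(E x̂ + E ŷ) ] / ( |X| (θ₁ − θ₂) ). -/

import Mathlib

open Matrix Finset
open scoped Classical

/-- A distance-regular graph `Γ` with vertex set `X`, path-length distance
`G.dist`, diameter `d ≥ 2`, and intersection numbers `p h i j`. -/
structure DRG where
  X : Type
  [fin : Fintype X]
  [deceq : DecidableEq X]
  G : SimpleGraph X
  conn : G.Connected
  d : ℕ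
  d_ge_two : 2 ≤ d
  dist_le : ∀ x y : X, G.dist x y ≤ d
  dist_attained : ∃ x y : X, G.dist x y = d
  p : ℕ → ℕ → ℕ → ℕ
  dist_regular : ∀ (h i j : ℕ) (x y : X), G.dist x y = h →
    (Finset.univ.filter fun z => G.dist x z = i ∧ G.dist y z = j).card = p h i j

attribute [instance] DRG.fin DRG.deceq

namespace DRG

variable (Γ : DRG)

/-- `Γ_i(x) = {z : ∂(x,z) = i}`. -/
noncomputable def sphere (x : Γ.X) (i : ℕ) : Finset Γ.X :=
  Finset.univ.filter fun z => Γ.G.dist x z = i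

/-- The number of vertices `|X|`, as a real number. -/
noncomputable def n : ℝ := (Fintype.card Γ.X : ℝ)

/-- The `i`-th distance matrix `A_i`. -/
noncomputable def Ai (i : ℕ) : Matrix Γ.X Γ.X ℝ :=
  Matrix.of fun x y => if Γ.G.dist x y = i then (1 : ℝ) else 0

/-- The adjacency matrix `A = A_1`. -/
noncomputable def A : Matrix Γ.X Γ.X ℝ := Γ.Ai 1

/-- The all-ones matrix `J`. -/
def Jmat : Matrix Γ.X Γ.X ℝ := Matrix.of fun _ _ => (1 : ℝ)

/-- `c_i = p^i_{1,i-1}` (so `c_0 = 0`). -/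
noncomputable def c (i : ℕ) : ℝ := (Γ.p i 1 (i - 1) : ℝ)

/-- `a_i = p^i_{1,i}`. -/
noncomputable def a (i : ℕ) : ℝ := (Γ.p i 1 i : ℝ)

/-- `b_i = p^i_{1,i+1}` (so `b_d = 0`). -/
noncomputable def b (i : ℕ) : ℝ := (Γ.p i 1 (i + 1) : ℝ)

/-- The standard basis vector `x̂`. -/
noncomputable def hatv (x : Γ.X) : Γ.X → ℝ := Pi.single x 1

/-- `x⁺_y = Σ_{z ∈ Γ(x) ∩ Γ_{i+1}(y)} ẑ` where `i = ∂(x,y)`. -/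
noncomputable def plusv (x y : Γ.X) : Γ.X → ℝ :=
  ∑ z ∈ Γ.sphere x 1 ∩ Γ.sphere y (Γ.G.dist x y + 1), Γ.hatv z

/-- `x⁰_y = Σ_{z ∈ Γ(x) ∩ Γ_i(y)} ẑ` where `i = ∂(x,y)`. -/
noncomputable def zerov (x y : Γ.X) : Γ.X → ℝ :=
  ∑ z ∈ Γ.sphere x 1 ∩ Γ.sphere y (Γ.G.dist x y), Γ.hatv z

/-- `x⁻_y = Σ_{z ∈ Γ(x) ∩ Γ_{i-1}(y)} ẑ` where `i = ∂(x,y)`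
(for `i = 0` this is the zero vector, matching `Γ_{-1}(y) = ∅`). -/
noncomputable def minusv (x y : Γ.X) : Γ.X → ℝ :=
  ∑ z ∈ Γ.sphere x 1 ∩ Γ.sphere y (Γ.G.dist x y - 1), Γ.hatv z

/-- The Norton product `u ⋆ v = E (u ∘ v)`, where `∘` is the entrywise
(Hadamard) product of vectors. -/
noncomputable def norton (E : Matrix Γ.X Γ.X ℝ) (u v : Γ.X → ℝ) : Γ.X → ℝ :=
  E *ᵥ (u * v)

/-- `E 0, …, E d` is the sequence of primitive idempotents of the Bose–Mesner
algebra, with `E 0 = |X|⁻¹ J`, and `θ 0, …, θ d` are the corresponding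
(mutually distinct) eigenvalues, so that `A = Σ_i θ i • E i`. -/
def IsPrimIdemSeq (E : ℕ → Matrix Γ.X Γ.X ℝ) (θ : ℕ → ℝ) : Prop :=
  E 0 = (Γ.n)⁻¹ • Γ.Jmat ∧
  ∑ i ∈ Finset.range (Γ.d + 1), E i = 1 ∧
  (∀ i j : ℕ, i ≤ Γ.d → j ≤ Γ.d → E i * E j = if i = j then E i else 0) ∧
  Γ.A = ∑ i ∈ Finset.range (Γ.d + 1), θ i • E i ∧
  (∀ i j : ℕ, i ≤ Γ.d → j ≤ Γ.d → θ i = θ j → i = j)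

/-- `q h i j` are the Krein parameters:
`E i ∘ E j = |X|⁻¹ Σ_h q h i j • E h`, with `∘` the entrywise product. -/
def IsKrein (E : ℕ → Matrix Γ.X Γ.X ℝ) (q : ℕ → ℕ → ℕ → ℝ) : Prop :=
  ∀ i j : ℕ, i ≤ Γ.d → j ≤ Γ.d →
    Matrix.hadamard (E i) (E j) =
      (Γ.n)⁻¹ • ∑ h ∈ Finset.range (Γ.d + 1), q h i j • E h

/-- The ordering `E 1, …, E d` is `Q`-polynomial: for `0 ≤ h,i,j ≤ d`,
`q h i j = 0` if one of `h,i,j` is greater than the sum of the other two, and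
`q h i j ≠ 0` if one of `h,i,j` equals the sum of the other two. -/
def IsQPolynomial (q : ℕ → ℕ → ℕ → ℝ) : Prop :=
  ∀ h i j : ℕ, h ≤ Γ.d → i ≤ Γ.d → j ≤ Γ.d →
    ((i + j < h ∨ h + j < i ∨ h + i < j) → q h i j = 0) ∧
    ((h = i + j ∨ i = h + j ∨ j = h + i) → q h i j ≠ 0)

/-- `ts 0, …, ts d` are the (mutually distinct) dual eigenvalues associated
with `E`, i.e. `E = |X|⁻¹ Σ_i ts i • A i`.  The values `ts (-1)` and
`ts (d+1)` are arbitrary reals (indeterminates). -/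
def IsDualEigs (E : Matrix Γ.X Γ.X ℝ) (ts : ℤ → ℝ) : Prop :=
  E = (Γ.n)⁻¹ • ∑ i ∈ Finset.range (Γ.d + 1), ts i • Γ.Ai i

/-- The dual eigenvalues `ts 0, …, ts d` are mutually distinct. -/
def DualDistinct (ts : ℤ → ℝ) : Prop :=
  ∀ i j : ℕ, i ≤ Γ.d → j ≤ Γ.d → ts i = ts j → i = j

/-- `C(x,y) = E x⁻_y − c_i ((θ*_1 − θ*_{i-1})/(θ*_0 − θ*_i)) E x̂`,
where `i = ∂(x,y)`. -/
noncomputable def Cvec (E : Matrix Γ.X Γ.X ℝ) (ts : ℤ → ℝ) (x y : Γ.X) :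
    Γ.X → ℝ :=
  E *ᵥ Γ.minusv x y -
    (Γ.c (Γ.G.dist x y) *
      ((ts 1 - ts ((Γ.G.dist x y : ℤ) - 1)) / (ts 0 - ts (Γ.G.dist x y)))) •
      (E *ᵥ Γ.hatv x)

/-- `B(x,y) = E x⁺_y − b_i ((θ*_1 − θ*_{i+1})/(θ*_0 − θ*_i)) E x̂`,
where `i = ∂(x,y)`. -/
noncomputable def Bvec (E : Matrix Γ.X Γ.X ℝ) (ts : ℤ → ℝ) (x y : Γ.X) :
    Γ.X → ℝ :=
  E *ᵥ Γ.plusv x y -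
    (Γ.b (Γ.G.dist x y) *
      ((ts 1 - ts ((Γ.G.dist x y : ℤ) + 1)) / (ts 0 - ts (Γ.G.dist x y)))) •
      (E *ᵥ Γ.hatv x)

variable {Γ : DRG} {E : ℕ → Matrix Γ.X Γ.X ℝ} {θ : ℕ → ℝ}

theorem n_ne_zero (Γ : DRG) : Γ.n ≠ 0 := by
  obtain ⟨x, -⟩ := Γ.dist_attained
  have : Nonempty Γ.X := ⟨x⟩
  simp [n]

theorem A_transpose (Γ : DRG) : Γ.Aᵀ = Γ.A := by
  ext x y
  simp only [A, Ai, Matrix.transpose_apply, Matrix.of_apply, Γ.G.dist_comm (u := y)]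

theorem IsDualEigs.apply {F : Matrix Γ.X Γ.X ℝ} {ts : ℤ → ℝ} (hts : Γ.IsDualEigs F ts)
    (x y : Γ.X) : F x y = Γ.n⁻¹ * ts (Γ.G.dist x y) := by
  rw [hts]
  simp [Matrix.sum_apply, Ai, Nat.lt_succ_of_le (Γ.dist_le x y)]

theorem IsPrimIdemSeq.A_mul (hE : Γ.IsPrimIdemSeq E θ) {i : ℕ} (hi : i ≤ Γ.d) :
    Γ.A * E i = θ i • E i := by
  obtain ⟨-, -, hmul, hA, -⟩ := hE
  rw [hA, Finset.sum_mul, Finset.sum_eq_single i]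
  · simp [hmul i i hi hi]
  · intro j hj hji
    rw [smul_mul_assoc, hmul j i (by simpa [Nat.lt_succ_iff] using hj) hi, if_neg hji, smul_zero]
  · intro h
    exact absurd (Finset.mem_range.2 (Nat.lt_succ_of_le hi)) h

theorem IsPrimIdemSeq.mul_A (hE : Γ.IsPrimIdemSeq E θ) {i : ℕ} (hi : i ≤ Γ.d) :
    E i * Γ.A = θ i • E i := by
  obtain ⟨-, -, hmul, hA, -⟩ := hE
  rw [hA, Finset.mul_sum, Finset.sum_eq_single i]
  · simp [hmul i i hi hi]
  · intro j hj hji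
    rw [mul_smul_comm, hmul i j hi (by simpa [Nat.lt_succ_iff] using hj), if_neg hji.symm,
      smul_zero]
  · intro h
    exact absurd (Finset.mem_range.2 (Nat.lt_succ_of_le hi)) h

/-- The primitive idempotents are symmetric matrices. -/
theorem IsPrimIdemSeq.transpose_eq (hE : Γ.IsPrimIdemSeq E θ) {i : ℕ} (hi : i ≤ Γ.d) :
    (E i)ᵀ = E i := by
  have horth : ∀ j ≤ Γ.d, j ≠ i → (E i)ᵀ * E j = 0 := by
    intro j hj hji
    have h1 : (E i)ᵀ * Γ.A = θ i • (E i)ᵀ := by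
      rw [← transpose_smul, ← hE.A_mul hi, transpose_mul, A_transpose]
    have h2 : θ i • ((E i)ᵀ * E j) = θ j • ((E i)ᵀ * E j) := by
      rw [← smul_mul_assoc, ← h1, mul_assoc, hE.A_mul hj, mul_smul_comm]
    have h3 : (θ i - θ j) • ((E i)ᵀ * E j) = 0 := by rw [sub_smul, h2, sub_self]
    exact (smul_eq_zero.1 h3).resolve_left
      fun h => hji (hE.2.2.2.2 i j hi hj (sub_eq_zero.1 h)).symm
  have hsum : (E i)ᵀ = (E i)ᵀ * E i := by
    conv_lhs => rw [← mul_one (E i)ᵀ, ← hE.2.1, Finset.mul_sum]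
    refine Finset.sum_eq_single i (fun j hj hji => horth j ?_ hji) fun h => ?_
    · simpa [Nat.lt_succ_iff] using hj
    · exact absurd (Finset.mem_range.2 (Nat.lt_succ_of_le hi)) h
  calc (E i)ᵀ = (E i)ᵀ * E i := hsum
    _ = ((E i)ᵀ * E i)ᵀ := by rw [transpose_mul, transpose_transpose]
    _ = E i := by rw [← hsum, transpose_transpose]

/-- If a symmetric idempotent `H` satisfies `(F ∘ F) H = 0` for a symmetric idempotent `F`,
then all triple products `F · diag (F y) · H` vanish. -/
theorem mul_diagonal_mul_eq_zero {X : Type*} [Fintype X] [DecidableEq X] {F H : Matrix X X ℝ}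
    (hFt : Fᵀ = F) (hF : F * F = F) (hHt : Hᵀ = H) (hH : H * H = H)
    (hFH : Matrix.hadamard F F * H = 0) (y : X) :
    F * diagonal (F y) * H = 0 := by
  have hFs : ∀ v w, F v w = F w v := fun v w => congrFun (congrFun hFt w) v
  have hHs : ∀ v w, H v w = H w v := fun v w => congrFun (congrFun hHt w) v
  have hFF : ∀ v w, ∑ z, F z v * F z w = F v w := fun v w => by
    conv_rhs => rw [← hF, Matrix.mul_apply]
    exact Finset.sum_congr rfl fun z _ => by rw [hFs z v]
  have hHH : ∀ v w, ∑ z, H v z * H w z = H v w := fun v w => by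
    conv_rhs => rw [← hH, Matrix.mul_apply]
    exact Finset.sum_congr rfl fun z _ => by rw [hHs z w]
  have happ : ∀ y z w, (F * diagonal (F y) * H) z w = ∑ v, F z v * F y v * H v w := by
    intro y z w
    rw [Matrix.mul_apply]
    exact Finset.sum_congr rfl fun v _ => by rw [Matrix.mul_diagonal]
  have hzero : ∑ y, ∑ z, ∑ w, (∑ v, F z v * F y v * H v w) ^ 2 = 0 := by
    calc ∑ y, ∑ z, ∑ w, (∑ v, F z v * F y v * H v w) ^ 2
        = ∑ y, ∑ z, ∑ w, ∑ v, ∑ u,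
            (F z v * F z u) * ((F y v * F y u) * (H v w * H u w)) := by
          refine Finset.sum_congr rfl fun y _ => Finset.sum_congr rfl fun z _ =>
            Finset.sum_congr rfl fun w _ => ?_
          rw [sq, Finset.sum_mul_sum]
          exact Finset.sum_congr rfl fun v _ => Finset.sum_congr rfl fun u _ => by ring
      _ = ∑ v, ∑ u, ∑ y, ∑ z, ∑ w,
            (F z v * F z u) * ((F y v * F y u) * (H v w * H u w)) := by
          have hswap : ∀ f : X → X → X → ℝ,
              ∑ w, ∑ v, ∑ u, f w v u = ∑ v, ∑ u, ∑ w, f w v u := fun f => by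
            rw [Finset.sum_comm]
            exact Finset.sum_congr rfl fun v _ => Finset.sum_comm
          exact (Finset.sum_congr rfl fun y _ =>
            (Finset.sum_congr rfl fun z _ => hswap _).trans (hswap _)).trans (hswap _)
      _ = ∑ v, ∑ u, F v u * (F v u * H v u) := by
          simp_rw [← Finset.mul_sum, hHH, ← Finset.sum_mul, ← Finset.mul_sum, hFF,
            ← Finset.sum_mul, hFF]
      _ = ∑ v, (Matrix.hadamard F F * H) v v := by
          refine Finset.sum_congr rfl fun v _ => ?_
          rw [Matrix.mul_apply]
          refine Finset.sum_congr rfl fun u _ => ?_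
          rw [Matrix.hadamard_apply, hHs v u]
          ring
      _ = 0 := by simp [hFH]
  ext z w
  rw [happ, Matrix.zero_apply]
  have h1 := (Finset.sum_eq_zero_iff_of_nonneg fun y _ => Finset.sum_nonneg fun z _ =>
    Finset.sum_nonneg fun w _ => sq_nonneg _).1 hzero y (Finset.mem_univ y)
  have h2 := (Finset.sum_eq_zero_iff_of_nonneg fun z _ =>
    Finset.sum_nonneg fun w _ => sq_nonneg _).1 h1 z (Finset.mem_univ z)
  have h3 := (Finset.sum_eq_zero_iff_of_nonneg fun w _ => sq_nonneg _).1 h2 w (Finset.mem_univ w)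
  exact pow_eq_zero_iff two_ne_zero |>.1 h3

theorem IsKrein.triple_eq_zero {q : ℕ → ℕ → ℕ → ℝ} (hE : Γ.IsPrimIdemSeq E θ)
    (hq : Γ.IsKrein E q) {h i : ℕ} (hh : h ≤ Γ.d) (hi : i ≤ Γ.d) (h0 : q h i i = 0) (y : Γ.X) :
    E i * diagonal (E i y) * E h = 0 := by
  have hmul := hE.2.2.1
  refine mul_diagonal_mul_eq_zero (hE.transpose_eq hi) ?_ (hE.transpose_eq hh) ?_ ?_ y
  · simp [hmul i i hi hi]
  · simp [hmul h h hh hh]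
  · rw [hq i i hi hi, smul_mul_assoc, Finset.sum_mul, Finset.sum_eq_zero, smul_zero]
    intro j hj
    rw [smul_mul_assoc, hmul j h (by simpa [Nat.lt_succ_iff] using hj) hh]
    split_ifs with hjh
    · rw [hjh, h0, zero_smul]
    · rw [smul_zero]

theorem mulVec_hatv (F : Matrix Γ.X Γ.X ℝ) (x z : Γ.X) : (F *ᵥ Γ.hatv x) z = F z x := by
  simp [hatv]

/-- The Norton product of `E x̂` and `E ŷ` satisfies this relation in every `Q`-polynomial
graph, whatever the distance from `x` to `y`. -/
theorem mulVec_diagonal_A (hE : Γ.IsPrimIdemSeq E θ) {q : ℕ → ℕ → ℕ → ℝ} (hq : Γ.IsKrein E q)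
    (hQ : Γ.IsQPolynomial q) (x y : Γ.X) :
    E 1 *ᵥ (diagonal (E 1 y) *ᵥ (Γ.A *ᵥ Γ.hatv x)) =
      (θ 2 * E 1 y x) • (E 1 *ᵥ Γ.hatv x) + ((θ 0 - θ 2) * Γ.n⁻¹) • (E 1 *ᵥ Γ.hatv y) +
        (θ 1 - θ 2) • Γ.norton (E 1) (E 1 *ᵥ Γ.hatv x) (E 1 *ᵥ Γ.hatv y) := by
  have hd := Γ.d_ge_two
  have h1d : 1 ≤ Γ.d := by omega
  have hsym : ∀ z w, E 1 z w = E 1 w z := fun z w =>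
    congrFun (congrFun (hE.transpose_eq h1d) w) z
  have hmat : E 1 * diagonal (E 1 y) * Γ.A - θ 2 • (E 1 * diagonal (E 1 y)) =
      (θ 0 - θ 2) • (E 1 * diagonal (E 1 y) * E 0) +
        (θ 1 - θ 2) • (E 1 * diagonal (E 1 y) * E 1) := by
    calc E 1 * diagonal (E 1 y) * Γ.A - θ 2 • (E 1 * diagonal (E 1 y))
        = ∑ h ∈ Finset.range (Γ.d + 1), (θ h - θ 2) • (E 1 * diagonal (E 1 y) * E h) := by
          conv_lhs =>
            rw [← mul_one (E 1 * diagonal (E 1 y)), mul_assoc _ 1 Γ.A, one_mul, ← hE.2.1,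
              hE.2.2.2.1]
          simp only [Finset.mul_sum, Finset.smul_sum, mul_smul_comm, sub_smul,
            Finset.sum_sub_distrib]
      _ = ∑ h ∈ Finset.range 2, (θ h - θ 2) • (E 1 * diagonal (E 1 y) * E h) := by
          symm
          refine Finset.sum_subset (Finset.range_subset_range.2 (by omega)) fun h hh hh' => ?_
          simp only [Finset.mem_range] at hh hh'
          rcases eq_or_ne h 2 with rfl | h2
          · rw [sub_self, zero_smul]
          · rw [hq.triple_eq_zero hE (by omega) h1d
              ((hQ h 1 1 (by omega) h1d h1d).1 (by omega)) y, smul_zero]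
      _ = _ := by rw [Finset.sum_range_succ, Finset.sum_range_one]
  have hvec := congrArg (· *ᵥ Γ.hatv x) (sub_eq_iff_eq_add.1 hmat)
  simp only [Matrix.add_mulVec, Matrix.smul_mulVec, ← Matrix.mulVec_mulVec] at hvec
  have e1 : diagonal (E 1 y) *ᵥ Γ.hatv x = E 1 y x • Γ.hatv x := by
    ext z
    by_cases hz : z = x <;> simp [hatv, Matrix.mulVec_diagonal, hz]
  have e2 : diagonal (E 1 y) *ᵥ (E 0 *ᵥ Γ.hatv x) = Γ.n⁻¹ • (E 1 *ᵥ Γ.hatv y) := by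
    ext z
    rw [Matrix.mulVec_diagonal, mulVec_hatv, Pi.smul_apply, mulVec_hatv, hE.1, hsym z y]
    simp [Jmat, mul_comm]
  have e3 : E 1 *ᵥ (diagonal (E 1 y) *ᵥ (E 1 *ᵥ Γ.hatv x)) =
      Γ.norton (E 1) (E 1 *ᵥ Γ.hatv x) (E 1 *ᵥ Γ.hatv y) := by
    rw [norton]
    congr 1
    ext z
    rw [Matrix.mulVec_diagonal, Pi.mul_apply, mulVec_hatv, mulVec_hatv, hsym z y, mul_comm]
  have e4 : E 1 *ᵥ (E 1 *ᵥ Γ.hatv y) = E 1 *ᵥ Γ.hatv y := by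
    rw [Matrix.mulVec_mulVec, hE.2.2.1 1 1 h1d h1d, if_pos rfl]
  rw [hvec, e1, e2, e3, Matrix.mulVec_smul, Matrix.mulVec_smul, e4]
  module

theorem minusv_apply (x y z : Γ.X) : Γ.minusv x y z =
    if Γ.G.dist x z = 1 ∧ Γ.G.dist y z = Γ.G.dist x y - 1 then 1 else 0 := by
  simp [minusv, hatv, sphere, Finset.sum_apply, Pi.single_apply]

/-- At the maximal distance, `E A*(y) A x̂` involves only `E x⁻_y` and `E x̂`. -/
theorem diagonal_A_hatv {ts : ℤ → ℝ} (hts : Γ.IsDualEigs (E 1) ts) {x y : Γ.X}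
    (hxy : Γ.G.dist x y = Γ.d) :
    diagonal (E 1 y) *ᵥ (Γ.A *ᵥ Γ.hatv x) =
      Γ.n⁻¹ • ((ts ((Γ.d : ℤ) - 1) - ts Γ.d) • Γ.minusv x y + ts Γ.d • (Γ.A *ᵥ Γ.hatv x)) := by
  have hd := Γ.d_ge_two
  ext z
  simp only [Matrix.mulVec_diagonal, Pi.smul_apply, Pi.add_apply, smul_eq_mul, mulVec_hatv,
    minusv_apply, hxy, hts.apply y z]
  have hA : Γ.A z x = if Γ.G.dist x z = 1 then 1 else 0 := by
    simp only [A, Ai, Matrix.of_apply, Γ.G.dist_comm (u := z)]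
  rw [hA]
  by_cases hz : Γ.G.dist x z = 1
  · have htri := Γ.conn.dist_triangle (u := x) (v := z) (w := y)
    have hle := Γ.dist_le y z
    rw [Γ.G.dist_comm (u := z)] at htri
    by_cases hyz : Γ.G.dist y z = Γ.d
    · have : Γ.d ≠ Γ.d - 1 := by omega
      simp [hz, hyz, this]
    · have hyz' : Γ.G.dist y z = Γ.d - 1 := by omega
      have hcast : ((Γ.d - 1 : ℕ) : ℤ) = (Γ.d : ℤ) - 1 := by omega
      simp [hz, hyz', hcast]
  · simp [hz]

/-- A sum over vertices that depends only on the distances to two given vertices. -/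
theorem sum_dist_eq (f : ℕ → ℕ → ℝ) (x y : Γ.X) :
    ∑ z, f (Γ.G.dist x z) (Γ.G.dist y z) =
      ∑ i ∈ Finset.range (Γ.d + 1), ∑ j ∈ Finset.range (Γ.d + 1),
        Γ.p (Γ.G.dist x y) i j * f i j := by
  have hmem : ∀ v w, Γ.G.dist v w ∈ Finset.range (Γ.d + 1) := fun v w =>
    Finset.mem_range.2 (Nat.lt_succ_of_le (Γ.dist_le v w))
  rw [← Finset.sum_product', ← Finset.sum_fiberwise_of_maps_to
    (g := fun z => (Γ.G.dist x z, Γ.G.dist y z))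
    (fun z _ => Finset.mk_mem_product (hmem x z) (hmem y z))]
  refine Finset.sum_congr rfl fun ij _ => ?_
  rw [← Γ.dist_regular _ ij.1 ij.2 x y rfl, ← nsmul_eq_mul, ← Finset.sum_const]
  refine Finset.sum_congr (by ext z; simp [Prod.ext_iff]) fun z hz => ?_
  obtain ⟨h1, h2⟩ := (Finset.mem_filter.1 hz).2
  rw [h1, h2]

theorem sum_dist_swap (f : ℕ → ℕ → ℝ) (x y : Γ.X) :
    ∑ z, f (Γ.G.dist x z) (Γ.G.dist y z) = ∑ z, f (Γ.G.dist y z) (Γ.G.dist x z) := by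
  rw [sum_dist_eq, sum_dist_eq, Γ.G.dist_comm (u := y)]

/-- The coordinates of `E x̂ ⋆ E ŷ` at `x` and at `y` agree. -/
theorem norton_apply_eq {F : Matrix Γ.X Γ.X ℝ} {ts : ℤ → ℝ} (hts : Γ.IsDualEigs F ts)
    (x y : Γ.X) :
    Γ.norton F (F *ᵥ Γ.hatv x) (F *ᵥ Γ.hatv y) x =
      Γ.norton F (F *ᵥ Γ.hatv x) (F *ᵥ Γ.hatv y) y := by
  have key := sum_dist_swap (fun i j => Γ.n⁻¹ * ts i * (Γ.n⁻¹ * ts i * (Γ.n⁻¹ * ts j))) x y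
  simp only [norton, Matrix.mulVec, dotProduct, Pi.mul_apply]
  change ∑ z, F x z * ((F *ᵥ Γ.hatv x) z * (F *ᵥ Γ.hatv y) z) =
    ∑ z, F y z * ((F *ᵥ Γ.hatv x) z * (F *ᵥ Γ.hatv y) z)
  simp only [mulVec_hatv, hts.apply, Γ.G.dist_comm (v := x), Γ.G.dist_comm (v := y)]
  rw [key]
  exact Finset.sum_congr rfl fun z _ => by rw [mul_comm (Γ.n⁻¹ * ts (Γ.G.dist x z))]

theorem sum_minusv (x y : Γ.X) : ∑ z, Γ.minusv x y z = Γ.c (Γ.G.dist x y) := by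
  simp only [minusv_apply, Finset.sum_boole, c, Γ.dist_regular _ 1 (Γ.G.dist x y - 1) x y rfl]

theorem mulVec_minusv_left {F : Matrix Γ.X Γ.X ℝ} {ts : ℤ → ℝ} (hts : Γ.IsDualEigs F ts)
    (x y : Γ.X) : (F *ᵥ Γ.minusv x y) x = Γ.n⁻¹ * ts 1 * Γ.c (Γ.G.dist x y) := by
  rw [← sum_minusv, Finset.mul_sum, Matrix.mulVec_eq_sum, Finset.sum_apply]
  refine Finset.sum_congr rfl fun z _ => ?_
  simp only [Pi.smul_apply, MulOpposite.smul_eq_mul_unop, MulOpposite.unop_op,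
    Matrix.transpose_apply, minusv_apply, hts.apply]
  split_ifs with h
  · simp [h.1]
  · simp

theorem mulVec_minusv_right {F : Matrix Γ.X Γ.X ℝ} {ts : ℤ → ℝ} (hts : Γ.IsDualEigs F ts)
    (x y : Γ.X) : (F *ᵥ Γ.minusv x y) y =
      Γ.n⁻¹ * ts ((Γ.G.dist x y - 1 : ℕ) : ℤ) * Γ.c (Γ.G.dist x y) := by
  rw [← sum_minusv, Finset.mul_sum, Matrix.mulVec_eq_sum, Finset.sum_apply]
  refine Finset.sum_congr rfl fun z _ => ?_
  simp only [Pi.smul_apply, MulOpposite.smul_eq_mul_unop, MulOpposite.unop_op,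
    Matrix.transpose_apply, minusv_apply, hts.apply]
  split_ifs with h
  · rw [h.2]
  · simp

/-- The Norton product at maximal distance, expressed through `E x⁻_y`, `E x̂` and `E ŷ`. -/
theorem norton_dist_d (hE : Γ.IsPrimIdemSeq E θ) {q : ℕ → ℕ → ℕ → ℝ} (hq : Γ.IsKrein E q)
    (hQ : Γ.IsQPolynomial q) {ts : ℤ → ℝ} (hts : Γ.IsDualEigs (E 1) ts) {x y : Γ.X}
    (hxy : Γ.G.dist x y = Γ.d) :
    (Γ.n * (θ 1 - θ 2)) • Γ.norton (E 1) (E 1 *ᵥ Γ.hatv x) (E 1 *ᵥ Γ.hatv y) =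
      (ts ((Γ.d : ℤ) - 1) - ts Γ.d) • (E 1 *ᵥ Γ.minusv x y) +
        (ts Γ.d * (θ 1 - θ 2)) • (E 1 *ᵥ Γ.hatv x) + (θ 2 - θ 0) • (E 1 *ᵥ Γ.hatv y) := by
  have hd := Γ.d_ge_two
  have hn := Γ.n_ne_zero
  have key := mulVec_diagonal_A hE hq hQ x y
  rw [diagonal_A_hatv hts hxy, Matrix.mulVec_smul, Matrix.mulVec_add, Matrix.mulVec_smul,
    Matrix.mulVec_smul, Matrix.mulVec_mulVec, hE.mul_A (by omega), Matrix.smul_mulVec,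
    hts.apply y x, Γ.G.dist_comm, hxy] at key
  ext z
  have hz := congrFun key z
  simp only [Pi.add_apply, Pi.smul_apply, smul_eq_mul] at hz ⊢
  field_simp at hz
  linarith

end DRG

/-- Corollary 4.6(ii): symmetric form, `i = d` case. -/
theorem DRG.norton_product_symmetric_dist_d (Γ : DRG) (E : ℕ → Matrix Γ.X Γ.X ℝ) (θ : ℕ → ℝ)
    (hE : Γ.IsPrimIdemSeq E θ)
    (q : ℕ → ℕ → ℕ → ℝ) (hq : Γ.IsKrein E q) (hQ : Γ.IsQPolynomial q)
    (ts : ℤ → ℝ) (hts : Γ.IsDualEigs (E 1) ts) (hts' : Γ.DualDistinct ts) (x y : Γ.X)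
    (hxy : Γ.G.dist x y = Γ.d) :
    Γ.norton (E 1) (E 1 *ᵥ Γ.hatv x) (E 1 *ᵥ Γ.hatv y) =
      (Γ.n * (θ 1 - θ 2))⁻¹ •
        ((ts ((Γ.d : ℤ) - 1) - ts (Γ.d : ℤ)) • Γ.Cvec (E 1) ts x y +
          (θ 2 - θ 0) • (E 1 *ᵥ Γ.hatv x + E 1 *ᵥ Γ.hatv y)) := by
  have hd := Γ.d_ge_two
  have hn := Γ.n_ne_zero
  have hθ : θ 1 - θ 2 ≠ 0 := fun h =>
    absurd (hE.2.2.2.2 1 2 (by omega) hd (sub_eq_zero.1 h)) (by norm_num)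
  have hts0 : ts 0 - ts Γ.d ≠ 0 := fun h => by
    have := hts' 0 Γ.d (Nat.zero_le _) le_rfl (by simpa using sub_eq_zero.1 h)
    omega
  have key := DRG.norton_dist_d hE hq hQ hts hxy
  have hscal : (ts ((Γ.d : ℤ) - 1) - ts Γ.d) *
      (Γ.c Γ.d * ((ts 1 - ts ((Γ.d : ℤ) - 1)) / (ts 0 - ts Γ.d))) =
        θ 2 - θ 0 - ts Γ.d * (θ 1 - θ 2) := by
    have hx := congrFun key x
    have hy := congrFun key y
    have hcast : ((Γ.d - 1 : ℕ) : ℤ) = (Γ.d : ℤ) - 1 := by omega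
    simp only [Pi.add_apply, Pi.smul_apply, smul_eq_mul, DRG.mulVec_hatv, hts.apply,
      DRG.mulVec_minusv_left hts, DRG.mulVec_minusv_right hts, SimpleGraph.dist_self,
      Γ.G.dist_comm (u := y) (v := x), hxy, hcast, Nat.cast_zero] at hx hy
    rw [← DRG.norton_apply_eq hts, hx] at hy
    field_simp at hy ⊢
    linear_combination hy
  rw [eq_inv_smul_iff₀ (mul_ne_zero hn hθ), key, DRG.Cvec, hxy, smul_sub, smul_smul, hscal]
  module
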